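/- arXiv:2403.12314 — 5 statements merged into one kernel-verified Lean document; each statement's English description precedes it below -/
import Mathlib

section
/- Let (A, Δ_0 = d, Δ_1, Δ_2, …) be a multicomplex over a field K of characteristic zero, and let (ι, ρ, h) be a deformation retract of (A, d) onto H. Then the transferred operators Δ'_n make H into a multicomplex with zero differential: for every n ≥ 0, ∑_{i=0}^n Δ'_i ∘ Δ'_{n−i} = 0 (equivalently, since Δ'_0 = 0, ∑_{i+j=n, i,j≥1} Δ'_i ∘ Δ'_j = 0 for all n ≥ 2). -/
/-- `Δ_{j₁} ∘ (h ∘ Δ_{j₂}) ∘ ⋯ ∘ (h ∘ Δ_{j_k})` for `L = [j₁, …, j_k]` (and `0` on `[]`). -/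
def chainOp {K : Type*} [Field K] {A : Type*} [AddCommGroup A] [Module K A]
    (Δ : ℕ → Module.End K A) (h : Module.End K A) : List ℕ → Module.End K A
  | [] => 0
  | j :: t => Δ j * (t.map fun i => h * Δ i).prod

/-- The transferred operators `Δ'_n = ∑ ρ ∘ Δ_{j₁} ∘ (h ∘ Δ_{j₂}) ∘ ⋯ ∘ (h ∘ Δ_{j_k}) ∘ ι`,
the sum ranging over all compositions `j₁ + ⋯ + j_k = n` with `j_i ≥ 1` (and `Δ'_0 = 0`). -/
noncomputable def transferred {K : Type*} [Field K] {A H : Type*}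
    [AddCommGroup A] [Module K A] [AddCommGroup H] [Module K H]
    (Δ : ℕ → Module.End K A) (ι : H →ₗ[K] A) (ρ : A →ₗ[K] H) (h : Module.End K A)
    (n : ℕ) : Module.End K H :=
  ∑ c : Composition n, ρ ∘ₗ chainOp Δ h c.blocks ∘ₗ ι

/-- The only composition of `0` is the empty one. -/
theorem sum_composition_zero {M : Type*} [AddCommMonoid M] (f : List ℕ → M) :
    ∑ c : Composition 0, f c.blocks = f [] := by
  have hblocks (c : Composition 0) : c.blocks = [] := by
    refine List.eq_nil_iff_forall_not_mem.2 fun i hi => ?_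
    have hpos := c.blocks_pos hi
    have hle := List.le_sum_of_mem hi
    rw [c.blocks_sum] at hle
    omega
  simp [hblocks, composition_card]

/-- A sum over the compositions of `n + 1` splits according to the first block. -/
theorem sum_composition_succ {M : Type*} [AddCommMonoid M] (f : List ℕ → M) (n : ℕ) :
    ∑ c : Composition (n + 1), f c.blocks =
      ∑ p ∈ Finset.HasAntidiagonal.antidiagonal n, ∑ c : Composition p.2, f ((p.1 + 1) :: c.blocks) := by
  rw [Finset.sum_sigma']
  symm
  refine Finset.sum_bij
    (fun x hx => (⟨(x.1.1 + 1) :: x.2.blocks, ?_, ?_⟩ : Composition (n + 1))) ?_ ?_ ?_ ?_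
  · intro i hi
    rcases List.mem_cons.1 hi with rfl | hi
    · omega
    · exact x.2.blocks_pos hi
  · have hx' := Finset.HasAntidiagonal.mem_antidiagonal.1 (Finset.mem_sigma.1 hx).1
    rw [List.sum_cons, x.2.blocks_sum]
    omega
  · simp
  · rintro ⟨⟨i, j⟩, c⟩ _ ⟨⟨i', j'⟩, c'⟩ _ heq
    have hblocks := congrArg Composition.blocks heq
    simp only [List.cons.injEq, add_left_inj] at hblocks
    obtain ⟨rfl, hb⟩ := hblocks
    obtain rfl : j = j' := by
      have hs := congrArg List.sum hb
      rwa [c.blocks_sum, c'.blocks_sum] at hs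
    obtain rfl : c = c' := Composition.ext hb
    rfl
  · rintro ⟨_ | ⟨b, t⟩, hpos, hsum⟩ _
    · simp at hsum
    · obtain ⟨i, rfl⟩ : ∃ i, b = i + 1 :=
        Nat.exists_eq_succ_of_ne_zero (hpos List.mem_cons_self).ne'
      rw [List.sum_cons] at hsum
      refine ⟨⟨(i, t.sum), ⟨t, fun hi => hpos (List.mem_cons_of_mem _ hi), rfl⟩⟩, ?_, rfl⟩
      simp only [Finset.mem_sigma, Finset.HasAntidiagonal.mem_antidiagonal, Finset.mem_univ, and_true]
      omega
  · intros
    rfl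

open PowerSeries in
/-- If `P` has no constant term, then `1 - P` is left cancellable on power series. -/
theorem PowerSeries.eq_zero_of_eq_mul_left {R : Type*} [Semiring R] {P W : R⟦X⟧}
    (hP : coeff 0 P = 0) (hW : W = P * W) : W = 0 := by
  ext n
  induction n using Nat.strong_induction_on with
  | _ n ih =>
    rw [hW, coeff_mul, map_zero]
    refine Finset.sum_eq_zero fun p hp => ?_
    rw [Finset.HasAntidiagonal.mem_antidiagonal] at hp
    by_cases h0 : p.1 = 0
    · rw [h0, hP, zero_mul]
    · rw [ih p.2 (by omega), map_zero, mul_zero]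

open PowerSeries in
/-- If `P` has no constant term, then `1 - P` is right cancellable on power series. -/
theorem PowerSeries.eq_zero_of_eq_mul_right {R : Type*} [Semiring R] {P W : R⟦X⟧}
    (hP : coeff 0 P = 0) (hW : W = W * P) : W = 0 := by
  ext n
  induction n using Nat.strong_induction_on with
  | _ n ih =>
    rw [hW, coeff_mul, map_zero]
    refine Finset.sum_eq_zero fun p hp => ?_
    rw [Finset.HasAntidiagonal.mem_antidiagonal] at hp
    by_cases h0 : p.2 = 0
    · rw [h0, hP, mul_zero]
    · rw [ih p.1 (by omega), map_zero, zero_mul]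

open PowerSeries in
/-- The homological perturbation identity for power series: if `d + D` squares to zero, `D` has
no constant term and `T = D + D h T`, then `d T + T d + T (1 + d h + h d) T = 0`. -/
theorem PowerSeries.perturbation_identity {R : Type*} [Ring R] {d D h T : R⟦X⟧}
    (hD : coeff 0 D = 0) (hmc : d * D + D * d + D * D = 0) (hT : T = D + D * h * T) :
    d * T + T * d + T * (1 + d * h + h * d) * T = 0 := by
  have hDh : coeff 0 (D * h) = 0 := by simp [coeff_mul, hD]
  have hhD : coeff 0 (h * D) = 0 := by simp [coeff_mul, hD]
  have hT' : T - D - T * h * D = 0 := by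
    refine eq_zero_of_eq_mul_left hDh ?_
    calc T - D - T * h * D = (D + D * h * T) - D - (D + D * h * T) * h * D := by rw [← hT]
      _ = D * h * (T - D - T * h * D) := by noncomm_ring
  have hl : (1 - D * h) * T = D := by
    rw [sub_mul, one_mul, sub_eq_iff_eq_add]
    exact hT
  have hr : T * (1 - h * D) = D := by
    rw [mul_sub, mul_one, ← mul_assoc, ← sub_eq_zero, ← hT']
    abel
  set Z := d * T + T * d + T * (1 + d * h + h * d) * T with hZ
  have key : (1 - D * h) * Z * (1 - h * D) = 0 := by
    calc (1 - D * h) * Z * (1 - h * D)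
        = (1 - D * h) * d * (T * (1 - h * D)) + ((1 - D * h) * T) * d * (1 - h * D)
          + ((1 - D * h) * T) * (1 + d * h + h * d) * (T * (1 - h * D)) := by
          rw [hZ]
          simp only [mul_add, add_mul, mul_assoc]
      _ = d * D + D * d + D * D := by
          rw [hl, hr]
          noncomm_ring
      _ = 0 := hmc
  have hZ' : (1 - D * h) * Z = 0 := by
    refine eq_zero_of_eq_mul_right hhD ?_
    rwa [mul_sub, mul_one, sub_eq_zero] at key
  refine eq_zero_of_eq_mul_left hDh ?_
  rwa [sub_mul, one_mul, sub_eq_zero] at hZ'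

theorem chainOp_nil {K A : Type*} [Field K] [AddCommGroup A] [Module K A]
    (Δ : ℕ → Module.End K A) (h : Module.End K A) : chainOp Δ h [] = 0 :=
  rfl

open PowerSeries in
/-- The generating series of the sums of `chainOp` over compositions solves `T = D + D h T`,
where `D` is the generating series of the `Δ n` with `n ≥ 1`. -/
theorem chainOp_series_eq {K A : Type*} [Field K] [AddCommGroup A] [Module K A]
    (Δ : ℕ → Module.End K A) (h : Module.End K A) :
    let D : (Module.End K A)⟦X⟧ := mk fun n => if n = 0 then 0 else Δ n
    let T : (Module.End K A)⟦X⟧ := mk fun n => ∑ c : Composition n, chainOp Δ h c.blocks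
    T = D + D * C h * T := by
  intro D T
  let Q : (Module.End K A)⟦X⟧ :=
    mk fun n => ∑ c : Composition n, (c.blocks.map fun i => h * Δ i).prod
  have hTQ : T = D * Q := by
    ext1 n
    cases n with
    | zero => simp [T, D, Q, coeff_mul, sum_composition_zero (chainOp Δ h), chainOp_nil]
    | succ n =>
      rw [coeff_mul, Finset.Nat.antidiagonal_succ, Finset.sum_cons, Finset.sum_map]
      simp only [T, D, Q, coeff_mk, sum_composition_succ (chainOp Δ h)]
      simp [chainOp, Finset.mul_sum]
      rfl
  have hQ : Q = 1 + C h * T := by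
    ext1 n
    cases n with
    | zero => simp [T, Q, sum_composition_zero (chainOp Δ h), chainOp_nil,
        sum_composition_zero fun l => (l.map fun i => h * Δ i).prod]
    | succ n =>
      simp only [T, Q, coeff_mk, map_add, coeff_C_mul, sum_composition_succ (chainOp Δ h),
        sum_composition_succ fun l => (l.map fun i => h * Δ i).prod]
      simp [chainOp, Finset.mul_sum, coeff_one, mul_assoc]
  calc T = D * Q := hTQ
    _ = D + D * C h * T := by rw [hQ, mul_add, mul_one, mul_assoc]

/-- The transferred operators make `H` into a multicomplex with zero differential. -/
theorem stmt_2 {K A H : Type*} [Field K] [CharZero K]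
    [AddCommGroup A] [Module K A] [AddCommGroup H] [Module K H]
    (Δ : ℕ → Module.End K A)
    (hmc : ∀ n : ℕ, ∑ i ∈ Finset.range (n + 1), Δ i * Δ (n - i) = 0)
    (ι : H →ₗ[K] A) (ρ : A →ₗ[K] H) (h : Module.End K A)
    (hρd : ρ ∘ₗ Δ 0 = 0) (hdι : Δ 0 ∘ₗ ι = 0) (hρι : ρ ∘ₗ ι = LinearMap.id)
    (hhtp : Δ 0 * h + h * Δ 0 = ι ∘ₗ ρ - 1) :
    ∀ n : ℕ, ∑ i ∈ Finset.range (n + 1),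
      transferred Δ ι ρ h i * transferred Δ ι ρ h (n - i) = 0 := by
  intro n
  let D : PowerSeries (Module.End K A) := PowerSeries.mk fun n => if n = 0 then 0 else Δ n
  let T : PowerSeries (Module.End K A) :=
    PowerSeries.mk fun n => ∑ c : Composition n, chainOp Δ h c.blocks
  have hsq : (PowerSeries.C (Δ 0) + D) * (PowerSeries.C (Δ 0) + D) = 0 := by
    have hΔ : PowerSeries.C (Δ 0) + D = PowerSeries.mk Δ := by
      ext1 m
      cases m <;> simp [D]
    rw [hΔ]
    ext1 m
    rw [PowerSeries.coeff_mul, Finset.Nat.sum_antidiagonal_eq_sum_range_succ_mk]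
    simpa using hmc m
  have hdd : Δ 0 * Δ 0 = 0 := by simpa using hmc 0
  have hmcD : PowerSeries.C (Δ 0) * D + D * PowerSeries.C (Δ 0) + D * D = 0 := by
    have hC : PowerSeries.C (Δ 0) * PowerSeries.C (Δ 0) = 0 := by
      rw [← map_mul, hdd, map_zero]
    rw [← hsq, add_mul, mul_add, mul_add, hC]
    abel
  have hZ := PowerSeries.perturbation_identity (by simp [D]) hmcD (chainOp_series_eq Δ h)
  have hproj : 1 + PowerSeries.C (Δ 0) * PowerSeries.C h + PowerSeries.C h * PowerSeries.C (Δ 0)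
      = PowerSeries.C (ι ∘ₗ ρ) := by
    rw [← map_mul, ← map_mul, add_assoc, ← map_add, hhtp, map_sub, map_one]
    abel
  rw [hproj] at hZ
  have hn := congrArg (PowerSeries.coeff n) hZ
  rw [map_add, map_add, PowerSeries.coeff_C_mul, PowerSeries.coeff_mul_C, PowerSeries.coeff_mul,
    Finset.Nat.sum_antidiagonal_eq_sum_range_succ_mk] at hn
  simp only [PowerSeries.coeff_mul_C, PowerSeries.coeff_mk, map_zero] at hn
  have htr (m : ℕ) : transferred Δ ι ρ h m =
      ρ ∘ₗ (∑ c : Composition m, chainOp Δ h c.blocks) ∘ₗ ι := by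
    ext x
    simp [transferred]
  have hρd' (x : A) : ρ (Δ 0 x) = 0 := LinearMap.congr_fun hρd x
  have hdι' (x : H) : Δ 0 (ι x) = 0 := LinearMap.congr_fun hdι x
  ext x
  have hx := congrArg ρ (LinearMap.congr_fun hn (ι x))
  simp only [LinearMap.add_apply, Module.End.mul_apply, hρd', hdι', map_add, map_zero, zero_add,
    LinearMap.zero_apply] at hx
  rw [LinearMap.sum_apply, map_sum] at hx
  rw [LinearMap.sum_apply, LinearMap.zero_apply, ← hx]
  refine Finset.sum_congr rfl fun i _ => ?_
  rw [htr, htr]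
  rfl
end

section
/- Let (A, Δ_0 = d, Δ_1, Δ_2, …) be a multicomplex over a field K of characteristic zero, and let (ι, ρ, h) be a deformation retract of (A, d) onto H. Define ρ_0 := ρ and, for n ≥ 1, ρ_n := ∑ ρ ∘ Δ_{j_1} ∘ h ∘ Δ_{j_2} ∘ h ∘ ⋯ ∘ Δ_{j_k} ∘ h : A → H, the sum ranging over all k ≥ 1 and all tuples (j_1, …, j_k) of integers j_i ≥ 1 with j_1 + ⋯ + j_k = n. Then for every n ≥ 0, ∑_{i+j=n} ρ_i ∘ Δ_j = ∑_{i+j=n} Δ'_i ∘ ρ_j (with Δ'_0 = 0); that is, the family (ρ_n) is an ∞-morphism of multicomplexes from (A, d, Δ_1, Δ_2, …) to (H, 0, Δ'_1, Δ'_2, …). In particular, if the degeneration property holds (Δ'_n = 0 for all n ≥ 1), then ∑_{i+j=n} ρ_i ∘ Δ_j = 0 for every n ≥ 0. -/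
/-- `Δ_{j₁} ∘ h ∘ Δ_{j₂} ∘ h ∘ ⋯ ∘ Δ_{j_k} ∘ h` for `L = [j₁, …, j_k]` (and `id` on `[]`). -/
def wordh {K : Type*} [Field K] {A : Type*} [AddCommGroup A] [Module K A]
    (Δ : ℕ → Module.End K A) (h : Module.End K A) (L : List ℕ) : Module.End K A :=
  (L.map fun i => Δ i * h).prod

/-- `ρ_n = ∑ ρ ∘ Δ_{j₁} ∘ h ∘ Δ_{j₂} ∘ h ∘ ⋯ ∘ Δ_{j_k} ∘ h`, the sum ranging over all
compositions `j₁ + ⋯ + j_k = n` with `j_i ≥ 1` (and `ρ_0 = ρ`). -/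
noncomputable def rhoFam {K : Type*} [Field K] {A H : Type*}
    [AddCommGroup A] [Module K A] [AddCommGroup H] [Module K H]
    (Δ : ℕ → Module.End K A) (ρ : A →ₗ[K] H) (h : Module.End K A) (n : ℕ) :
    A →ₗ[K] H :=
  ∑ c : Composition n, ρ ∘ₗ wordh Δ h c.blocks

/-- The generating series of the family obtained by summing `G` over the blocks of compositions. -/
noncomputable def compositionSeries {R : Type*} [Semiring R] (G : List ℕ → R) : PowerSeries R :=
  PowerSeries.mk fun n => ∑ c : Composition n, G c.blocks

theorem Composition.sum_zero_blocks {M : Type*} [AddCommMonoid M] (G : List ℕ → M) :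
    ∑ c : Composition 0, G c.blocks = G [] := by
  have hnil (c : Composition 0) : c.blocks = [] :=
    List.eq_nil_iff_forall_not_mem.2 fun i hi =>
      (c.blocks_pos hi).ne' (List.sum_eq_zero_iff.1 c.blocks_sum i hi)
  rw [Fintype.sum_eq_single (⟨[], by simp, rfl⟩ : Composition 0)
    fun c hc => absurd (Composition.ext (hnil c)) hc]

/-- Summing over compositions of `n + 1` by splitting off the first block. -/
theorem Composition.sum_succ_blocks {M : Type*} [AddCommMonoid M] (G : List ℕ → M) (n : ℕ) :
    ∑ c : Composition (n + 1), G c.blocks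
      = ∑ p ∈ Finset.HasAntidiagonal.antidiagonal n,
          ∑ c : Composition p.2, G ((p.1 + 1) :: c.blocks) := by
  rw [Finset.sum_sigma']
  symm
  refine Finset.sum_bij
    (fun x hx => ⟨(x.1.1 + 1) :: x.2.blocks, ?_, ?_⟩) (fun _ _ => Finset.mem_univ _) ?_ ?_
    (fun _ _ => rfl)
  · intro i hi
    rcases List.mem_cons.1 hi with rfl | hi
    · exact Nat.succ_pos _
    · exact x.2.blocks_pos hi
  · have := Finset.HasAntidiagonal.mem_antidiagonal.1 (Finset.mem_sigma.1 hx).1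
    rw [List.sum_cons, x.2.blocks_sum]
    omega
  · rintro ⟨⟨i, j⟩, c⟩ _ ⟨⟨i', j'⟩, c'⟩ _ hcc
    simp only [Composition.mk.injEq, List.cons.injEq, Nat.add_right_cancel_iff] at hcc
    obtain ⟨rfl, hb⟩ := hcc
    obtain rfl : j = j' := c.blocks_sum.symm.trans ((congrArg List.sum hb).trans c'.blocks_sum)
    obtain rfl : c = c' := Composition.ext hb
    rfl
  · rintro ⟨L, hpos, hsum⟩ _
    rcases L with _ | ⟨a, t⟩
    · simp at hsum
    · have ha : 0 < a := hpos List.mem_cons_self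
      rw [List.sum_cons] at hsum
      refine ⟨⟨(a - 1, t.sum), ⟨t, fun hi => hpos (List.mem_cons_of_mem _ hi), rfl⟩⟩, ?_, ?_⟩
      · simp only [Finset.mem_sigma, Finset.HasAntidiagonal.mem_antidiagonal, Finset.mem_univ,
          and_true]
        omega
      · ext1
        simp only [List.cons.injEq, and_true]
        omega

/-- The power series of a sequence with its constant term removed. -/
noncomputable def positivePart {R : Type*} [Semiring R] (f : ℕ → R) : PowerSeries R :=
  PowerSeries.mk fun n => if n = 0 then 0 else f n

theorem compositionSeries_eq_add_mul {R : Type*} [Semiring R] (G G' : List ℕ → R) (f : ℕ → R)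
    (hG : ∀ j t, G (j :: t) = f j * G' t) :
    compositionSeries G = PowerSeries.C (G []) + positivePart f * compositionSeries G' := by
  ext n
  cases n with
  | zero => simp [compositionSeries, positivePart, Composition.sum_zero_blocks]
  | succ n =>
    rw [map_add, PowerSeries.coeff_mul, Finset.Nat.sum_antidiagonal_succ]
    simp [compositionSeries, positivePart, Composition.sum_succ_blocks, hG, Finset.mul_sum]

theorem compositionSeries_prod_mul_one_sub {R : Type*} [Ring R] (f : ℕ → R) :
    compositionSeries (fun L => (L.map f).prod) * (1 - positivePart f) = 1 := by
  have hr : (1 - positivePart f) * compositionSeries (fun L => (L.map f).prod) = 1 := by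
    have := compositionSeries_eq_add_mul (fun L => (L.map f).prod) (fun L => (L.map f).prod) f
      (by simp)
    rw [sub_mul, one_mul, sub_eq_iff_eq_add]
    simpa using this
  have hl := PowerSeries.invOfUnit_mul (1 - positivePart f) 1
    (by
    rw [map_sub, ← PowerSeries.coeff_zero_eq_constantCoeff_apply (positivePart f)]
    simp only [positivePart, PowerSeries.coeff_mk]
    simp)
  rwa [left_inv_eq_right_inv hl hr] at hl

theorem perturbation_identity {R : Type*} [Ring R] {d D h P W : R} (hd : d * d = 0)
    (hD : (d + D) * (d + D) = 0) (hP : d * h + h * d = P - 1)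
    (hl : W = 1 + W * (D * h)) (hr : W = 1 + D * h * W) :
    W * (d + D) = d * W + W * D * P * W := by
  have hDd : D * d = -(d * D) - D * D := by
    have : d * d + d * D + (D * d + D * D) = 0 := by rw [← hD]; noncomm_ring
    rw [hd] at this
    rw [← sub_eq_zero, ← this]
    abel
  have h1 : W * D * h = W - 1 := by rw [mul_assoc]; exact eq_sub_of_add_eq' hl.symm
  have h2 : D * h * W = W - 1 := eq_sub_of_add_eq' hr.symm
  obtain rfl : P = 1 + (d * h + h * d) := by rw [hP]; abel
  have e : W * D * (1 + (d * h + h * d)) * W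
      = W * D * W + W * (D * d) * h * W + W * D * h * d * W := by noncomm_ring
  have e' : W * (-(d * D) - D * D) * h * W = -(W * d * (D * h * W)) - W * D * (D * h * W) := by
    noncomm_ring
  rw [e, hDd, e', h1, h2]
  noncomm_ring

theorem mk_eq_C_add_positivePart {R : Type*} [Semiring R] (f : ℕ → R) :
    PowerSeries.mk f = PowerSeries.C (f 0) + positivePart f := by
  ext n
  cases n <;> simp [positivePart]

theorem positivePart_mul_right {R : Type*} [Semiring R] (f : ℕ → R) (a : R) :
    positivePart (fun i => f i * a) = positivePart f * PowerSeries.C a := by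
  ext n
  simp [positivePart, PowerSeries.coeff_mul_C]

theorem positivePart_mul_left {R : Type*} [Semiring R] (f : ℕ → R) (a : R) :
    positivePart (fun i => a * f i) = PowerSeries.C a * positivePart f := by
  ext n
  simp [positivePart, PowerSeries.coeff_C_mul]

section

variable {K A : Type*} [Field K] [AddCommGroup A] [Module K A]
  (Δ : ℕ → Module.End K A) (h : Module.End K A)

theorem compositionSeries_wordh_left :
    compositionSeries (wordh Δ h)
      = 1 + compositionSeries (wordh Δ h) * (positivePart Δ * PowerSeries.C h) := by
  have := compositionSeries_prod_mul_one_sub (fun i => Δ i * h)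
  rw [positivePart_mul_right, mul_sub, mul_one, sub_eq_iff_eq_add] at this
  exact this

theorem compositionSeries_wordh_right :
    compositionSeries (wordh Δ h)
      = 1 + positivePart Δ * PowerSeries.C h * compositionSeries (wordh Δ h) := by
  rw [← positivePart_mul_right]
  simpa [wordh] using compositionSeries_eq_add_mul (wordh Δ h) (wordh Δ h) (fun i => Δ i * h)
    (by simp [wordh])

theorem compositionSeries_chainOp :
    compositionSeries (chainOp Δ h) = compositionSeries (wordh Δ h) * positivePart Δ := by
  set V := compositionSeries fun L => (L.map fun i => h * Δ i).prod
  have hX : compositionSeries (chainOp Δ h) = positivePart Δ * V := by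
    simpa [chainOp] using compositionSeries_eq_add_mul (chainOp Δ h) _ Δ (fun _ _ => rfl)
  have hV : V = 1 + PowerSeries.C h * positivePart Δ * V := by
    rw [← positivePart_mul_left]
    simpa using compositionSeries_eq_add_mul (fun L => (L.map fun i => h * Δ i).prod)
      (fun L => (L.map fun i => h * Δ i).prod) (fun i => h * Δ i) (by simp)
  have hW := compositionSeries_wordh_left Δ h
  set W := compositionSeries (wordh Δ h)
  set D := positivePart Δ
  have hWV : W * D * V = W * D + W * D * (PowerSeries.C h * D * V) := by
    conv_lhs => rw [hV]
    rw [mul_add, mul_one]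
  have hWV' : W * D * V = D * V + W * (D * PowerSeries.C h) * D * V := by
    conv_lhs => rw [hW]
    noncomm_ring
  rw [hX]
  have : D * V + W * (D * PowerSeries.C h) * D * V
      = W * D + W * (D * PowerSeries.C h) * D * V := by
    rw [← hWV', hWV]
    noncomm_ring
  exact add_right_cancel this

variable {H : Type*} [AddCommGroup H] [Module K H]

theorem rhoFam_eq_comp_coeff (ρ : A →ₗ[K] H) (n : ℕ) :
    rhoFam Δ ρ h n = ρ ∘ₗ PowerSeries.coeff n (compositionSeries (wordh Δ h)) := by
  ext x
  simp [rhoFam, compositionSeries]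

theorem transferred_eq_comp_coeff (ι : H →ₗ[K] A) (ρ : A →ₗ[K] H) (n : ℕ) :
    transferred Δ ι ρ h n
      = ρ ∘ₗ PowerSeries.coeff n (compositionSeries (chainOp Δ h)) ∘ₗ ι := by
  ext x
  simp [transferred, compositionSeries]

theorem transferred_zero (ι : H →ₗ[K] A) (ρ : A →ₗ[K] H) : transferred Δ ι ρ h 0 = 0 := by
  rw [transferred, Composition.sum_zero_blocks (fun L => ρ ∘ₗ chainOp Δ h L ∘ₗ ι), chainOp,
    LinearMap.zero_comp, LinearMap.comp_zero]

end

/-- The family `(ρ_n)` is an `∞`-morphism of multicomplexes from `(A, d, Δ₁, Δ₂, …)` to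
`(H, 0, Δ'₁, Δ'₂, …)`; in particular if the degeneration property holds then
`∑_{i+j=n} ρ_i ∘ Δ_j = 0` for all `n`. -/
theorem stmt_3 {K A H : Type*} [Field K] [CharZero K]
    [AddCommGroup A] [Module K A] [AddCommGroup H] [Module K H]
    (Δ : ℕ → Module.End K A)
    (hmc : ∀ n : ℕ, ∑ i ∈ Finset.range (n + 1), Δ i * Δ (n - i) = 0)
    (ι : H →ₗ[K] A) (ρ : A →ₗ[K] H) (h : Module.End K A)
    (hρd : ρ ∘ₗ Δ 0 = 0) (hdι : Δ 0 ∘ₗ ι = 0) (hρι : ρ ∘ₗ ι = LinearMap.id)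
    (hhtp : Δ 0 * h + h * Δ 0 = ι ∘ₗ ρ - 1) :
    (∀ n : ℕ, ∑ i ∈ Finset.range (n + 1), rhoFam Δ ρ h i ∘ₗ Δ (n - i)
        = ∑ i ∈ Finset.range (n + 1), transferred Δ ι ρ h i ∘ₗ rhoFam Δ ρ h (n - i)) ∧
    ((∀ m : ℕ, 1 ≤ m → transferred Δ ι ρ h m = 0) →
      ∀ n : ℕ, ∑ i ∈ Finset.range (n + 1), rhoFam Δ ρ h i ∘ₗ Δ (n - i) = 0) := by
  have main : ∀ n : ℕ, ∑ i ∈ Finset.range (n + 1), rhoFam Δ ρ h i ∘ₗ Δ (n - i)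
      = ∑ i ∈ Finset.range (n + 1), transferred Δ ι ρ h i ∘ₗ rhoFam Δ ρ h (n - i) := by
    intro n
    set P : Module.End K A := ι ∘ₗ ρ with hPdef
    have hD : PowerSeries.mk Δ * PowerSeries.mk Δ = 0 := by
      ext1 m
      rw [PowerSeries.coeff_mul, Finset.Nat.sum_antidiagonal_eq_sum_range_succ_mk]
      simpa using hmc m
    rw [mk_eq_C_add_positivePart] at hD
    have key := perturbation_identity (P := PowerSeries.C P)
      (by rw [← map_mul, show Δ 0 * Δ 0 = 0 by simpa using hmc 0, map_zero]) hD
      (by rw [← map_mul, ← map_mul, ← map_add, hhtp, map_sub, map_one])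
      (compositionSeries_wordh_left Δ h) (compositionSeries_wordh_right Δ h)
    rw [← mk_eq_C_add_positivePart, ← compositionSeries_chainOp] at key
    replace key := congrArg (fun φ => ρ ∘ₗ PowerSeries.coeff n φ) key
    simp only [map_add, LinearMap.comp_add, PowerSeries.coeff_C_mul] at key
    rw [Module.End.mul_eq_comp, ← LinearMap.comp_assoc, hρd, LinearMap.zero_comp, zero_add,
      PowerSeries.coeff_mul, PowerSeries.coeff_mul,
      Finset.Nat.sum_antidiagonal_eq_sum_range_succ_mk,
      Finset.Nat.sum_antidiagonal_eq_sum_range_succ_mk] at key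
    simp only [rhoFam_eq_comp_coeff, transferred_eq_comp_coeff]
    ext x
    simpa [PowerSeries.coeff_mul_C, hPdef] using LinearMap.congr_fun key x
  refine ⟨main, fun hdeg n => ?_⟩
  rw [main]
  refine Finset.sum_eq_zero fun i _ => ?_
  obtain rfl | hi := Nat.eq_zero_or_pos i
  · rw [transferred_zero, LinearMap.zero_comp]
  · rw [hdeg i hi, LinearMap.zero_comp]
end

section
/- Let (A, Δ_0 = d, Δ_1, Δ_2, …) be a multicomplex over a field K of characteristic zero, and let (ι, ρ, h) be a deformation retract of (A, d) onto H. Define q_0 := id_A − ι ∘ ρ and q_n := −h ∘ Δ_n for n ≥ 1. Then for every n ≥ 0, d ∘ q_n = ∑_{i+j=n} q_i ∘ Δ_j; that is, the family (q_n) is an ∞-morphism of multicomplexes from (A, d, Δ_1, Δ_2, …) to (A, d, 0, 0, …). -/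
/-- The family `q_0 = id_A - ι ∘ ρ` and `q_n = -(h ∘ Δ_n)` for `n ≥ 1`. -/
def qFam {K : Type*} [Field K] {A H : Type*}
    [AddCommGroup A] [Module K A] [AddCommGroup H] [Module K H]
    (Δ : ℕ → Module.End K A) (ι : H →ₗ[K] A) (ρ : A →ₗ[K] H) (h : Module.End K A) :
    ℕ → Module.End K A
  | 0 => 1 - ι ∘ₗ ρ
  | n + 1 => -(h * Δ (n + 1))

/-- The family `(q_n)` is an `∞`-morphism of multicomplexes from `(A, d, Δ₁, Δ₂, …)` to
`(A, d, 0, 0, …)`: for every `n`, `d ∘ q_n = ∑_{i+j=n} q_i ∘ Δ_j`. -/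
theorem stmt_4 {K A H : Type*} [Field K] [CharZero K]
    [AddCommGroup A] [Module K A] [AddCommGroup H] [Module K H]
    (Δ : ℕ → Module.End K A)
    (hmc : ∀ n : ℕ, ∑ i ∈ Finset.range (n + 1), Δ i * Δ (n - i) = 0)
    (ι : H →ₗ[K] A) (ρ : A →ₗ[K] H) (h : Module.End K A)
    (hρd : ρ ∘ₗ Δ 0 = 0) (hdι : Δ 0 ∘ₗ ι = 0) (hρι : ρ ∘ₗ ι = LinearMap.id)
    (hhtp : Δ 0 * h + h * Δ 0 = ι ∘ₗ ρ - 1) :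
    ∀ n : ℕ, Δ 0 * qFam Δ ι ρ h n
      = ∑ i ∈ Finset.range (n + 1), qFam Δ ι ρ h i * Δ (n - i) := by
  rintro (_ | n)
  · have hdP : Δ 0 * (ι ∘ₗ ρ) = 0 := by
      rw [Module.End.mul_eq_comp, ← LinearMap.comp_assoc, hdι, LinearMap.zero_comp]
    have hPd : (ι ∘ₗ ρ) * Δ 0 = 0 := by
      rw [Module.End.mul_eq_comp, LinearMap.comp_assoc, hρd, LinearMap.comp_zero]
    simp [qFam, mul_sub, sub_mul, hdP, hPd]
  · have hq : (1 : Module.End K A) - ι ∘ₗ ρ = -(Δ 0 * h + h * Δ 0) := by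
      rw [hhtp, neg_sub]
    have hΔ := hmc (n + 1)
    rw [Finset.sum_range_succ', add_eq_zero_iff_eq_neg] at hΔ
    rw [Finset.sum_range_succ']
    simp only [qFam, neg_mul, mul_assoc, Finset.sum_neg_distrib, ← Finset.mul_sum, hΔ, hq,
      Nat.sub_zero]
    noncomm_ring
end

section
/- Let (A, Δ_0 = d, Δ_1, Δ_2, …) be a multicomplex over a field K of characteristic zero, and let (ι, ρ, h) be a deformation retract of (A, d) onto H such that ρ ∘ Δ_1 ∘ ι = 0. Then the operator φ_1 := h ∘ Δ_1 − ι ∘ ρ ∘ Δ_1 ∘ h satisfies φ_1 ∘ d − d ∘ φ_1 = Δ_1; that is, φ_1 is a first-order solution of the gauge equation. -/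
/-- Let `p` be an element of a ring with `p * d = d * p = 0` and `d * h + h * d = p - 1`. If `D`
anticommutes with `d` and `p * D * p = 0`, then `D` is the commutator of
`h * D - p * (D * h)` with `d`. -/
theorem commutator_eq_of_homotopy {R : Type*} [Ring R] {d D h p : R}
    (hdD : d * D + D * d = 0) (hpd : p * d = 0) (hdp : d * p = 0)
    (hhtp : d * h + h * d = p - 1) (hpDp : p * D * p = 0) :
    (h * D - p * (D * h)) * d - d * (h * D - p * (D * h)) = D := by
  have key : (h * D - p * (D * h)) * d - d * (h * D - p * (D * h)) - D =
      h * (d * D + D * d) - (d * h + h * d - (p - 1)) * D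
        - p * D * (d * h + h * d - (p - 1)) + p * (d * D + D * d) * h
        - p * d * D * h + d * p * D * h - p * D * p := by
    noncomm_ring
  rw [← sub_eq_zero, key, hdD, hpd, hdp, hhtp, hpDp]
  simp

/-- For a multicomplex `(A, Δ₀ = d, Δ₁, …)` and a deformation retract `(ι, ρ, h)` with
`ρ ∘ Δ₁ ∘ ι = 0`, the operator `φ₁ = h ∘ Δ₁ - ι ∘ ρ ∘ Δ₁ ∘ h` is a first-order solution
of the gauge equation: `φ₁ ∘ d - d ∘ φ₁ = Δ₁`. -/
theorem stmt_5 {K A H : Type*} [Field K] [CharZero K]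
    [AddCommGroup A] [Module K A] [AddCommGroup H] [Module K H]
    (Δ : ℕ → Module.End K A)
    (hmc : ∀ n : ℕ, ∑ i ∈ Finset.range (n + 1), Δ i * Δ (n - i) = 0)
    (ι : H →ₗ[K] A) (ρ : A →ₗ[K] H) (h : Module.End K A)
    (hρd : ρ ∘ₗ Δ 0 = 0) (hdι : Δ 0 ∘ₗ ι = 0) (hρι : ρ ∘ₗ ι = LinearMap.id)
    (hhtp : Δ 0 * h + h * Δ 0 = ι ∘ₗ ρ - 1)
    (hρΔι : ρ ∘ₗ Δ 1 ∘ₗ ι = 0) :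
    let φ₁ : Module.End K A := h * Δ 1 - (ι ∘ₗ ρ) * (Δ 1 * h)
    φ₁ * Δ 0 - Δ 0 * φ₁ = Δ 1 := by
  refine commutator_eq_of_homotopy ?_ ?_ ?_ hhtp ?_
  · simpa [Finset.sum_range_succ] using hmc 1
  · rw [Module.End.mul_eq_comp, LinearMap.comp_assoc, hρd, LinearMap.comp_zero]
  · rw [Module.End.mul_eq_comp, ← LinearMap.comp_assoc, hdι, LinearMap.zero_comp]
  · ext x
    simpa using congrArg ι (LinearMap.congr_fun hρΔι (ρ x))
end

section
/- Let A be a ℤ-graded, graded-commutative, associative unital algebra over a field K of characteristic zero. Suppose d is a homogeneous operator of degree 1 and algebraic order ≤ 1 (d ∈ 𝒟_1^1) and Λ is a homogeneous operator of degree −2 and algebraic order ≤ 2 (Λ ∈ 𝒟_2^{−2}). For k ≥ 1 define Δ_k := (1/k!) [Λ, [Λ, ⋯, [Λ, d]⋯]] (k-fold iterated graded commutator). Then Δ_k is a homogeneous operator of degree 1 − 2k and algebraic order ≤ k + 1, i.e., Δ_k ∈ 𝒟_{k+1}^{1−2k}, for every k ≥ 1. -/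
/-- `f` is a homogeneous operator of degree `k`: `f(A^i) ⊆ A^{i+k}` for all `i`. -/
def IsHomog {K B : Type*} [Field K] [Ring B] [Algebra K B]
    (𝒜 : ℤ → Submodule K B) (k : ℤ) (f : Module.End K B) : Prop :=
  ∀ i : ℤ, ∀ a ∈ 𝒜 i, f a ∈ 𝒜 (i + k)

/-- The graded commutator `[f, g] = f ∘ g − (−1)^{kℓ} g ∘ f` of operators of degrees `k, ℓ`. -/
noncomputable def gComm (K : Type*) [Field K] {B : Type*} [Ring B] [Algebra K B]
    (k ℓ : ℤ) (f g : Module.End K B) : Module.End K B :=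
  f * g - ((-1 : K) ^ (k * ℓ)) • (g * f)

/-- Grothendieck's operators of degree `k` and algebraic order `≤ r`:
`𝒟₀ᵏ = {L_a : a ∈ A^k}` and `𝒟_{r+1}^k` consists of the homogeneous operators `f` of
degree `k` such that `[L_a, f] ∈ 𝒟_r^{k+j}` for all homogeneous `a ∈ A^j`. -/
noncomputable def Dorder {K B : Type*} [Field K] [Ring B] [Algebra K B]
    (𝒜 : ℤ → Submodule K B) : ℕ → ℤ → Set (Module.End K B)
  | 0, k => {f | ∃ a ∈ 𝒜 k, f = LinearMap.mulLeft K a}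
  | r + 1, k => {f | IsHomog 𝒜 k f ∧
      ∀ j : ℤ, ∀ a ∈ 𝒜 j, gComm K j k (LinearMap.mulLeft K a) f ∈ Dorder 𝒜 r (k + j)}

section GradedCommutator

variable {K B : Type*} [Field K] [Ring B] [Algebra K B]

theorem gComm_add_right (k l : ℤ) (f g h : Module.End K B) :
    gComm K k l f (g + h) = gComm K k l f g + gComm K k l f h := by
  simp only [gComm, mul_add, add_mul, smul_add]
  abel

theorem gComm_smul_right (k l : ℤ) (c : K) (f g : Module.End K B) :
    gComm K k l f (c • g) = c • gComm K k l f g := by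
  simp only [gComm, mul_smul_comm, smul_mul_assoc, smul_sub, smul_comm c]

theorem neg_one_zpow_mul_self (n : ℤ) : (-1 : K) ^ n * (-1 : K) ^ n = 1 := by
  rw [← mul_zpow]
  simp

theorem gComm_swap (k l : ℤ) (f g : Module.End K B) :
    gComm K k l f g = (-(-1 : K) ^ (k * l)) • gComm K l k g f := by
  simp only [gComm, smul_sub, smul_smul, mul_comm l k, neg_mul, neg_one_zpow_mul_self,
    neg_smul, one_smul]
  abel

/-- The graded Jacobi identity. -/
theorem gComm_jacobi (j k l : ℤ) (a f g : Module.End K B) :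
    gComm K j (k + l) a (gComm K k l f g) =
      gComm K (k + j) l (gComm K j k a f) g +
        ((-1 : K) ^ (j * k)) • gComm K k (l + j) f (gComm K j l a g) := by
  have hne : (-1 : K) ≠ 0 := by simp
  have hp := neg_one_zpow_mul_self (K := K) (j * k)
  simp only [gComm, mul_add, add_mul, zpow_add₀ hne, mul_comm k j]
  generalize (-1 : K) ^ (j * k) = p at *
  generalize (-1 : K) ^ (j * l) = q
  generalize (-1 : K) ^ (k * l) = t
  simp only [mul_sub, sub_mul, smul_sub, mul_smul_comm, smul_mul_assoc, smul_smul, mul_assoc]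
  have h₁ : p * (t * p) = t := by linear_combination t * hp
  have h₂ : p * (t * (p * q)) = t * q := by linear_combination t * q * hp
  simp only [h₁, h₂, mul_comm q t, mul_left_comm p t, mul_comm q p]
  abel

theorem IsHomog.gComm_mem {𝒜 : ℤ → Submodule K B} {k l : ℤ} {f g : Module.End K B}
    (hf : IsHomog 𝒜 k f) (hg : IsHomog 𝒜 l g) : IsHomog 𝒜 (k + l) (gComm K k l f g) := by
  intro i a ha
  refine Submodule.sub_mem _ ?_ (Submodule.smul_mem _ _ ?_)
  · have := hf _ _ (hg _ _ ha)
    rwa [add_assoc, add_comm l k] at this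
  · have := hg _ _ (hf _ _ ha)
    rwa [add_assoc] at this

variable (𝒜 : ℤ → Submodule K B)

theorem Dorder.add_mem {r : ℕ} {k : ℤ} {f g : Module.End K B}
    (hf : f ∈ Dorder 𝒜 r k) (hg : g ∈ Dorder 𝒜 r k) : f + g ∈ Dorder 𝒜 r k := by
  induction r generalizing k f g with
  | zero =>
    obtain ⟨a, ha, rfl⟩ := hf
    obtain ⟨b, hb, rfl⟩ := hg
    exact ⟨a + b, Submodule.add_mem _ ha hb, by ext x; simp [add_mul]⟩
  | succ r ih =>
    refine ⟨fun i a ha => Submodule.add_mem _ (hf.1 i a ha) (hg.1 i a ha), fun j a ha => ?_⟩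
    rw [gComm_add_right]
    exact ih (hf.2 j a ha) (hg.2 j a ha)

theorem Dorder.smul_mem {r : ℕ} {k : ℤ} (c : K) {f : Module.End K B}
    (hf : f ∈ Dorder 𝒜 r k) : c • f ∈ Dorder 𝒜 r k := by
  induction r generalizing k f with
  | zero =>
    obtain ⟨a, ha, rfl⟩ := hf
    exact ⟨c • a, Submodule.smul_mem _ c ha, by ext x; simp⟩
  | succ r ih =>
    refine ⟨fun i a ha => Submodule.smul_mem _ c (hf.1 i a ha), fun j a ha => ?_⟩
    rw [gComm_smul_right]
    exact ih (hf.2 j a ha)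

/-- The graded commutator of operators of orders `≤ r` and `≤ s` has order `≤ r + s - 1`. -/
theorem Dorder.gComm_mem {n r s : ℕ} (h : r + s = n + 1) {k l : ℤ} {f g : Module.End K B}
    (hf : f ∈ Dorder 𝒜 r k) (hg : g ∈ Dorder 𝒜 s l) :
    gComm K k l f g ∈ Dorder 𝒜 n (k + l) := by
  induction n generalizing r s k l f g with
  | zero =>
    obtain ⟨rfl, rfl⟩ | ⟨rfl, rfl⟩ : (r = 0 ∧ s = 1) ∨ (r = 1 ∧ s = 0) := by lia
    · obtain ⟨a, ha, rfl⟩ := hf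
      rw [add_comm k l]
      exact hg.2 k a ha
    · obtain ⟨a, ha, rfl⟩ := hg
      rw [gComm_swap]
      exact Dorder.smul_mem 𝒜 _ (hf.2 l a ha)
  | succ n ih =>
    rcases r with _ | r
    · obtain rfl : s = n + 1 + 1 := by lia
      obtain ⟨a, ha, rfl⟩ := hf
      rw [add_comm k l]
      exact hg.2 k a ha
    rcases s with _ | s
    · obtain rfl : r = n + 1 := by lia
      obtain ⟨a, ha, rfl⟩ := hg
      rw [gComm_swap]
      exact Dorder.smul_mem 𝒜 _ (hf.2 l a ha)
    refine ⟨hf.1.gComm_mem hg.1, fun j a ha => ?_⟩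
    rw [gComm_jacobi]
    have h₁ := ih (by lia) (hf.2 j a ha) hg
    have h₂ := ih (by lia) hf (hg.2 j a ha)
    rw [add_right_comm] at h₁
    rw [← add_assoc] at h₂
    exact Dorder.add_mem 𝒜 h₁ (Dorder.smul_mem 𝒜 _ h₂)

theorem Dorder.iterate_commutator_mem {d Λ : Module.End K B}
    (hd : d ∈ Dorder 𝒜 1 1) (hΛ : Λ ∈ Dorder 𝒜 2 (-2)) (k : ℕ) :
    (fun y => Λ * y - y * Λ)^[k] d ∈ Dorder 𝒜 (k + 1) (1 - 2 * (k : ℤ)) := by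
  induction k with
  | zero => simpa using hd
  | succ k ih =>
    rw [Function.iterate_succ_apply']
    have h := Dorder.gComm_mem 𝒜 (n := k + 1 + 1) (by lia) hΛ ih
    have hsign : (-1 : K) ^ (-2 * (1 - 2 * (k : ℤ))) = 1 :=
      Even.neg_one_zpow ((even_neg.mpr even_two).mul_right _)
    have hdeg : -2 + (1 - 2 * (k : ℤ)) = 1 - 2 * ((k + 1 : ℕ) : ℤ) := by
      push_cast
      ring
    rwa [gComm, hsign, one_smul, hdeg] at h

end GradedCommutator

/-- If `d ∈ 𝒟₁¹` and `Λ ∈ 𝒟₂⁻²`, then `Δ_k = (1/k!)[Λ,[Λ,⋯,[Λ,d]⋯]]` (the `k`-fold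
iterated commutator; since `Λ` has even degree the graded commutator is the ordinary
one) lies in `𝒟_{k+1}^{1-2k}` for every `k ≥ 1`. -/
theorem stmt_9 {K B : Type*} [Field K] [CharZero K] [Ring B] [Algebra K B]
    (𝒜 : ℤ → Submodule K B) [GradedAlgebra 𝒜]
    (hcomm : ∀ (i j : ℤ), ∀ a ∈ 𝒜 i, ∀ b ∈ 𝒜 j,
      a * b = ((-1 : K) ^ (i * j)) • (b * a))
    (d Λ : Module.End K B)
    (hd : d ∈ Dorder 𝒜 1 1) (hΛ : Λ ∈ Dorder 𝒜 2 (-2)) :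
    ∀ k : ℕ, 1 ≤ k →
      (k.factorial : K)⁻¹ • ((fun y => Λ * y - y * Λ)^[k] d)
        ∈ Dorder 𝒜 (k + 1) (1 - 2 * (k : ℤ)) := by
  intro k _
  exact Dorder.smul_mem 𝒜 _ (Dorder.iterate_commutator_mem 𝒜 hd hΛ k)
end
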